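/- Consider a DABA execution in which the window remains nonempty. Suppose a fixup call executes the flip case so that immediately after the flip pointer updates |l_L| = |l_R| = m > 0 and |l_A| = 0. Then that same fixup call continues with a shrink step, the next m − 1 fixup calls each execute exactly the shrink case, after which |l_L| = |l_R| = 0 and |l_A| = m; the following m fixup calls each execute exactly the shift case, after which |l_L| = |l_R| = |l_A| = 0; and the next fixup call executes the flip case again. Consequently, between consecutive flips the number of shrink steps equals the number of shift steps, and the total number of ⊗ invocations performed inside these 2m fixup calls is 3m (an average of 1.5 per fixup call, hence an average of 2.5 ⊗ invocations per insert and 1.5 per evict). -/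

import Mathlib

/-!
STATEMENT 14: Consider a DABA execution in which the window remains nonempty.
Suppose a fixup call executes the flip case so that immediately after the flip
pointer updates `|l_L| = |l_R| = m > 0` and `|l_A| = 0`. Then that same fixup
call continues with a shrink step, the next `m − 1` fixup calls each execute
exactly the shrink case, after which `|l_L| = |l_R| = 0` and `|l_A| = m`; the
following `m` fixup calls each execute exactly the shift case, after which
`|l_L| = |l_R| = |l_A| = 0`; and the next fixup call executes the flip case
again. Consequently, between consecutive flips the number of shrink steps
equals the number of shift steps, and the total number of `⊗` invocations
performed inside these `2m` fixup calls is `3m`.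
-/

namespace Daba

variable {M : Type*} [Monoid M]

/-- A DABA state: a deque of `(val, agg)` pairs and pointers `L ≤ R ≤ A ≤ B ≤ n`. -/
structure State (M : Type*) where
  q : List (M × M)
  L : ℕ
  R : ℕ
  A : ℕ
  B : ℕ

/-- `aggB = deque[n−1].agg` if `B < n`, `1` otherwise. -/
def aggB (s : State M) : M :=
  if s.B < s.q.length then (s.q.getD (s.q.length - 1) (1, 1)).2 else 1

/-- `aggL = deque[L].agg` if `L < R`, `1` otherwise. -/
def aggL (s : State M) : M := if s.L < s.R then (s.q.getD s.L (1, 1)).2 else 1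

/-- `aggR = deque[A−1].agg` if `R < A`, `1` otherwise. -/
def aggR (s : State M) : M :=
  if s.R < s.A then (s.q.getD (s.A - 1) (1, 1)).2 else 1

/-- `aggA = deque[A].agg` if `A < B`, `1` otherwise. -/
def aggA (s : State M) : M := if s.A < s.B then (s.q.getD s.A (1, 1)).2 else 1

/-- Overwrite the `agg` field of `deque[i]`, keeping its `val` field. -/
def setAgg (q : List (M × M)) (i : ℕ) (x : M) : List (M × M) :=
  q.set i ((q.getD i (1, 1)).1, x)

/-- The state immediately after the flip pointer updates
`L ← 0, A ← n, B ← n` (with `R` unchanged). -/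
def flipped (s : State M) : State M :=
  ⟨s.q, 0, s.R, s.q.length, s.q.length⟩

/-- `fixup()`. -/
def fixup (s : State M) : State M :=
  let n := s.q.length
  if s.B = 0 then ⟨s.q, n, n, n, n⟩
  else
    let s1 : State M := if s.L = s.B then flipped s else s
    if s1.L = s1.R then ⟨s1.q, s1.L + 1, s1.R + 1, s1.A + 1, s1.B⟩
    else
      let s2 : State M :=
        ⟨setAgg s1.q s1.L (aggL s1 * aggR s1 * aggA s1), s1.L + 1, s1.R, s1.A, s1.B⟩
      ⟨setAgg s2.q (s2.A - 1) ((s2.q.getD (s2.A - 1) (1, 1)).1 * aggA s2),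
        s2.L, s2.R, s2.A - 1, s2.B⟩

/-- Number of `⊗` invocations made by a `fixup()` call: three in the shrink
case, zero in the singleton, flip, and shift cases. -/
def fixupCost (s : State M) : ℕ :=
  if s.B = 0 then 0
  else
    let s1 : State M := if s.L = s.B then flipped s else s
    if s1.L = s1.R then 0 else 3

/-- Window operations: insert a value, or evict the oldest value. -/
inductive DOp (M : Type*) where
  | ins (v : M)
  | evict

/-- The state just before the `fixup()` call of an operation: insert pushes
`(v, aggB ⊗ v)` to the back; evict removes `deque[0]` (each pointer decreases
by one). -/
def preFix (s : State M) : DOp M → State M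
  | .ins v => ⟨s.q ++ [(v, aggB s * v)], s.L, s.R, s.A, s.B⟩
  | .evict => ⟨s.q.tail, s.L - 1, s.R - 1, s.A - 1, s.B - 1⟩

/-- A complete insert or evict operation. -/
def applyOp (s : State M) (o : DOp M) : State M := fixup (preFix s o)

/-- The DABA size invariants, with exact subtraction. -/
def SizeInv (s : State M) : Prop :=
  (s.B = 0 ∧ s.q.length = 0) ∨
  ((s.R - s.L) + (s.A - s.R) + (s.B - s.A) + 1 + (s.q.length - s.B) = s.B ∧
    s.R - s.L = s.A - s.R)

/-- This fixup call executes the flip case. -/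
def ExecFlip (p : State M) : Prop := p.B ≠ 0 ∧ p.L = p.B

/-- This fixup call executes exactly the shrink case (no singleton, no flip,
no shift). -/
def ExecShrinkOnly (p : State M) : Prop :=
  p.B ≠ 0 ∧ p.L ≠ p.B ∧ p.L ≠ p.R

/-- This fixup call executes exactly the shift case (no singleton, no flip,
no shrink). -/
def ExecShiftOnly (p : State M) : Prop :=
  p.B ≠ 0 ∧ p.L ≠ p.B ∧ p.L = p.R

/-- Pointer layout with `|l_L| = |l_R| = l`, `|l_A| = a`. -/
def Lay (s : State M) (l a : ℕ) : Prop :=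
  1 ≤ s.L ∧ s.R = s.L + l ∧ s.A = s.R + l ∧ s.B = s.A + a ∧ s.B ≤ s.q.length

theorem setAgg_length (q : List (M × M)) (i : ℕ) (x : M) :
    (setAgg q i x).length = q.length := by simp [setAgg]

theorem preFix_lay {s : State M} {l a : ℕ} (h : Lay s l a) (o : DOp M) :
    (preFix s o).R = (preFix s o).L + l ∧ (preFix s o).A = (preFix s o).R + l ∧
    (preFix s o).B = (preFix s o).A + a ∧ (preFix s o).B ≤ (preFix s o).q.length := by
  obtain ⟨h1, h2, h3, h4, h5⟩ := h
  cases o <;> simp [preFix] <;> omega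

theorem shrink_lay {s : State M} {l a : ℕ} (h : Lay s (l + 1) a) (o : DOp M) :
    ExecShrinkOnly (preFix s o) ∧ Lay (applyOp s o) l (a + 1) ∧
      fixupCost (preFix s o) = 3 := by
  obtain ⟨h2, h3, h4, h5⟩ := preFix_lay h o
  unfold applyOp
  generalize preFix s o = p at *
  have e1 : p.B ≠ 0 := by omega
  have e2 : p.L ≠ p.B := by omega
  have e3 : p.L ≠ p.R := by omega
  refine ⟨⟨e1, e2, e3⟩, ?_, ?_⟩
  · simp only [fixup, e1, e2, e3, if_false, Lay, setAgg_length]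
    omega
  · simp only [fixupCost, e1, e2, e3, if_false]

theorem shift_lay {s : State M} {a : ℕ} (h : Lay s 0 (a + 1)) (o : DOp M) :
    ExecShiftOnly (preFix s o) ∧ Lay (applyOp s o) 0 a ∧
      fixupCost (preFix s o) = 0 := by
  obtain ⟨h2, h3, h4, h5⟩ := preFix_lay h o
  unfold applyOp
  generalize preFix s o = p at *
  have e1 : p.B ≠ 0 := by omega
  have e2 : p.L ≠ p.B := by omega
  have e3 : p.L = p.R := by omega
  refine ⟨⟨e1, e2, e3⟩, ?_, ?_⟩
  · simp only [fixup, e1, e2, if_false, if_pos e3, Lay]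
    omega
  · simp only [fixupCost, e1, e2, if_false, if_pos e3]

theorem flip_shrink_shift_cycle (m : ℕ) (hm : 0 < m)
    (trace : ℕ → State M) (ops : ℕ → DOp M)
    -- the execution: each step performs an insert or evict
    (hstep : ∀ k, k ≤ 2 * m → trace (k + 1) = applyOp (trace k) (ops k))
    -- the window remains nonempty
    (hne : ∀ k, k ≤ 2 * m + 1 → (trace k).q ≠ [])
    -- the size invariants hold before and after every operation
    (hsize : ∀ k, k ≤ 2 * m + 1 → SizeInv (trace k))
    -- fixup call 0 executes the flip case, and immediately after the flip
    -- pointer updates, |l_L| = |l_R| = m > 0 and |l_A| = 0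
    (hflip : ExecFlip (preFix (trace 0) (ops 0)))
    (hLm : (flipped (preFix (trace 0) (ops 0))).R
            - (flipped (preFix (trace 0) (ops 0))).L = m)
    (hRm : (flipped (preFix (trace 0) (ops 0))).A
            - (flipped (preFix (trace 0) (ops 0))).R = m)
    (hA0 : (flipped (preFix (trace 0) (ops 0))).B
            - (flipped (preFix (trace 0) (ops 0))).A = 0) :
    -- that same fixup call continues with a shrink step
    (flipped (preFix (trace 0) (ops 0))).L ≠ (flipped (preFix (trace 0) (ops 0))).R ∧
    -- the next m − 1 fixup calls each execute exactly the shrink case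
    (∀ k, 1 ≤ k → k < m → ExecShrinkOnly (preFix (trace k) (ops k))) ∧
    -- after which |l_L| = |l_R| = 0 and |l_A| = m
    ((trace m).R - (trace m).L = 0 ∧ (trace m).A - (trace m).R = 0 ∧
      (trace m).B - (trace m).A = m) ∧
    -- the following m fixup calls each execute exactly the shift case
    (∀ k, m ≤ k → k < 2 * m → ExecShiftOnly (preFix (trace k) (ops k))) ∧
    -- after which |l_L| = |l_R| = |l_A| = 0
    ((trace (2 * m)).R - (trace (2 * m)).L = 0 ∧
      (trace (2 * m)).A - (trace (2 * m)).R = 0 ∧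
      (trace (2 * m)).B - (trace (2 * m)).A = 0) ∧
    -- the next fixup call executes the flip case again
    ExecFlip (preFix (trace (2 * m)) (ops (2 * m))) ∧
    -- total ⊗ invocations inside these 2m fixup calls is 3m
    (∑ k ∈ Finset.range (2 * m), fixupCost (preFix (trace k) (ops k))) = 3 * m := by
  have hR : (preFix (trace 0) (ops 0)).R = m := by simpa [flipped] using hLm
  have hn : (preFix (trace 0) (ops 0)).q.length = 2 * m := by
    simp only [flipped] at hRm; omega
  obtain ⟨f1, f2⟩ := hflip
  have e3 : ¬ (0 = (preFix (trace 0) (ops 0)).R) := by omega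
  have c0 : fixupCost (preFix (trace 0) (ops 0)) = 3 := by
    simp only [fixupCost, f1, if_false, if_pos f2, flipped, e3]
  have l1 : Lay (trace 1) (m - 1) 1 := by
    rw [show (1 : ℕ) = 0 + 1 from rfl, hstep 0 (by omega), applyOp]
    simp only [fixup, f1, if_false, if_pos f2, flipped, e3, Lay, setAgg_length]
    omega
  have A : ∀ k, 1 ≤ k → k ≤ m → Lay (trace k) (m - k) k := by
    intro k hk
    induction k, hk using Nat.le_induction with
    | base => intro _; exact l1
    | succ k hk ih =>
      intro hkm
      have := ih (by omega)
      rw [show m - k = (m - (k + 1)) + 1 by omega] at this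
      rw [hstep k (by omega)]
      exact (shrink_lay this _).2.1
  have A' : ∀ k, 1 ≤ k → k < m → ExecShrinkOnly (preFix (trace k) (ops k)) ∧
      fixupCost (preFix (trace k) (ops k)) = 3 := by
    intro k hk hkm
    have := A k hk hkm.le
    rw [show m - k = (m - (k + 1)) + 1 by omega] at this
    exact ⟨(shrink_lay this _).1, (shrink_lay this _).2.2⟩
  have Bl : ∀ k, m ≤ k → k ≤ 2 * m → Lay (trace k) 0 (2 * m - k) := by
    intro k hk
    induction k, hk using Nat.le_induction with
    | base =>
      intro _
      have := A m hm le_rfl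
      rw [Nat.sub_self] at this
      rwa [show 2 * m - m = m by omega]
    | succ k hk ih =>
      intro hkm
      have := ih (by omega)
      rw [show 2 * m - k = (2 * m - (k + 1)) + 1 by omega] at this
      rw [hstep k (by omega)]
      exact (shift_lay this _).2.1
  have B' : ∀ k, m ≤ k → k < 2 * m → ExecShiftOnly (preFix (trace k) (ops k)) ∧
      fixupCost (preFix (trace k) (ops k)) = 0 := by
    intro k hk hkm
    have := Bl k hk hkm.le
    rw [show 2 * m - k = (2 * m - (k + 1)) + 1 by omega] at this
    exact ⟨(shift_lay this _).1, (shift_lay this _).2.2⟩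
  have Lm := Bl m le_rfl (by omega)
  have L2 := Bl (2 * m) (by omega) le_rfl
  refine ⟨e3, fun k h1 h2 => (A' k h1 h2).1, ?_, fun k h1 h2 => (B' k h1 h2).1, ?_, ?_, ?_⟩
  · obtain ⟨_, _, _, _, _⟩ := Lm; omega
  · obtain ⟨_, _, _, _, _⟩ := L2; omega
  · obtain ⟨g2, g3, g4, g5⟩ := preFix_lay L2 (ops (2 * m))
    refine ⟨fun hB => ?_, by omega⟩
    have hs := hsize (2 * m) (by omega)
    have hne' := hne (2 * m + 1) le_rfl
    rw [hstep (2 * m) le_rfl, applyOp] at hne'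
    simp only [fixup, if_pos hB] at hne'
    have hpos := List.length_pos_iff.mpr hne'
    obtain ⟨k1, k2, k3, k4, k5⟩ := L2
    unfold SizeInv at hs
    cases ho : ops (2 * m) with
    | ins v => rw [ho] at hB; simp only [preFix] at hB; omega
    | evict =>
      rw [ho] at hB hpos
      simp only [preFix, List.length_tail] at hB hpos
      omega
  · have hlow : ∀ k ∈ Finset.range m, fixupCost (preFix (trace k) (ops k)) = 3 := by
      intro k hk
      rcases Nat.eq_zero_or_pos k with rfl | h
      · exact c0
      · exact (A' k h (Finset.mem_range.mp hk)).2
    have hhigh : ∀ k ∈ Finset.range m,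
        fixupCost (preFix (trace (m + k)) (ops (m + k))) = 0 := by
      intro k hk
      have := Finset.mem_range.mp hk
      exact (B' (m + k) (by omega) (by omega)).2
    rw [two_mul, Finset.sum_range_add, Finset.sum_congr rfl hlow, Finset.sum_congr rfl hhigh]
    simp [mul_comm]

end Daba
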